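/- arXiv:2301.08910 — 4 statements merged into one kernel-verified Lean document; each statement's English description precedes it below -/
import Mathlib

section
/- Fix n×n real symmetric positive semidefinite matrices A₁, …, A_d, a real symmetric positive definite n×n matrix J, and a real number D > 0. Then the set { p ∈ ℝ^d : p_i ≥ 0 for all i, and trace( (∑_{i=1}^d p_i A_i + J)⁻¹ ) ≤ D } is a convex subset of ℝ^d. -/
open Matrix

lemma trace_inv_aux {n : ℕ} (X W : Matrix (Fin n) (Fin n) ℝ) (hX : X.PosDef)
    (hW : Wᴴ = W) : 0 ≤ X⁻¹.trace - 2 * W.trace + (W * X * W).trace := by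
  have hu : IsUnit X.det := (Matrix.isUnit_iff_isUnit_det _).1 hX.isUnit
  have h := (hX.posSemidef.conjTranspose_mul_mul_same (X⁻¹ - W)).trace_nonneg
  have hs : (X⁻¹ - W)ᴴ = X⁻¹ - W := by
    rw [conjTranspose_sub, hW, hX.inv.isHermitian.eq]
  have e : (X⁻¹ - W) * X * (X⁻¹ - W) = X⁻¹ - W - W + W * X * W := by
    rw [sub_mul, nonsing_inv_mul _ hu, sub_mul, mul_sub, mul_sub, one_mul, one_mul,
      mul_assoc W X X⁻¹, mul_nonsing_inv _ hu, mul_one]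
    abel
  rw [hs, e, trace_add, trace_sub, trace_sub] at h
  linarith

/-- **Convexity of the ACRB constraint set.** For positive semidefinite symmetric
matrices `A₁, …, A_d`, a symmetric positive definite matrix `J` and `D > 0`, the set
`{ p : p_i ≥ 0 ∀ i, trace ((∑ i, p i • A i + J)⁻¹) ≤ D }` is convex. -/
theorem stmt_8 {n d : ℕ} (A : Fin d → Matrix (Fin n) (Fin n) ℝ)
    (J : Matrix (Fin n) (Fin n) ℝ)
    (hAsymm : ∀ i, (A i).IsSymm) (hApsd : ∀ i, (A i).PosSemidef)
    (hJsymm : J.IsSymm) (hJ : J.PosDef) (D : ℝ) (hD : 0 < D) :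
    Convex ℝ { p : Fin d → ℝ |
      (∀ i, 0 ≤ p i) ∧ ((∑ i, p i • A i) + J)⁻¹.trace ≤ D } := by
  have key : ∀ p : Fin d → ℝ, (∀ i, 0 ≤ p i) → ((∑ i, p i • A i) + J).PosDef := by
    intro p hp
    exact Matrix.PosDef.posSemidef_add
      (Matrix.posSemidef_sum _ fun i _ => (hApsd i).smul (hp i)) hJ
  rintro p ⟨hp, hpD⟩ q ⟨hq, hqD⟩ a b ha hb hab
  have hr : ∀ i, 0 ≤ (a • p + b • q) i := fun i => by
    have := mul_nonneg ha (hp i)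
    have := mul_nonneg hb (hq i)
    simp only [Pi.add_apply, Pi.smul_apply, smul_eq_mul]
    linarith
  refine ⟨hr, ?_⟩
  have hX := key p hp
  have hY := key q hq
  have hZ := key _ hr
  have hZe : (∑ i, (a • p + b • q) i • A i) + J
      = a • ((∑ i, p i • A i) + J) + b • ((∑ i, q i • A i) + J) := by
    have hJ1 : J = a • J + b • J := by rw [← add_smul, hab, one_smul]
    simp only [Pi.add_apply, Pi.smul_apply, smul_eq_mul, add_smul, mul_smul,
      Finset.sum_add_distrib, ← Finset.smul_sum, smul_add]
    nth_rewrite 1 [hJ1]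
    abel
  generalize (∑ i, (a • p + b • q) i • A i) + J = Z at *
  generalize (∑ i, p i • A i) + J = X at *
  generalize (∑ i, q i • A i) + J = Y at *
  have hW := hZ.inv.isHermitian.eq
  have h1 := trace_inv_aux X Z⁻¹ hX hW
  have h2 := trace_inv_aux Y Z⁻¹ hY hW
  have hu : IsUnit Z.det := (Matrix.isUnit_iff_isUnit_det _).1 hZ.isUnit
  have h3 : (Z⁻¹ * Z * Z⁻¹).trace
      = a * (Z⁻¹ * X * Z⁻¹).trace + b * (Z⁻¹ * Y * Z⁻¹).trace := by
    have : Z⁻¹ * Z * Z⁻¹ = a • (Z⁻¹ * X * Z⁻¹) + b • (Z⁻¹ * Y * Z⁻¹) := by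
      have : ∀ W : Matrix (Fin n) (Fin n) ℝ,
          W * Z * W = a • (W * X * W) + b • (W * Y * W) := by
        intro W
        rw [hZe]
        simp [mul_add, add_mul]
      exact this _
    rw [this, trace_add, trace_smul, trace_smul, smul_eq_mul, smul_eq_mul]
  rw [nonsing_inv_mul _ hu, one_mul] at h3
  have g1 := mul_nonneg ha h1
  have g2 := mul_nonneg hb h2
  have g3 := mul_le_mul_of_nonneg_left hpD ha
  have g4 := mul_le_mul_of_nonneg_left hqD hb
  obtain rfl : b = 1 - a := by linarith
  nlinarith
end

section
/- Fix n×n real symmetric positive semidefinite matrices A₁, …, A_d, a real symmetric positive definite n×n matrix J, nonnegative real numbers c₁, …, c_d, and positive reals P, P_max, D. Define the feasible set F = { p ∈ ℝ^d : 0 ≤ p_i ≤ P_max for all i, ∑_i p_i ≤ P, and trace( (∑_i p_i A_i + J)⁻¹ ) ≤ D }, and the objective f(p) = ∑_{i=1}^d log₂(1 + c_i p_i). Then F is convex and f is concave on F; that is, for all p, q ∈ F and t ∈ [0,1], t•p + (1−t)•q ∈ F and f(t•p + (1−t)•q) ≥ t f(p) + (1−t) f(q). -/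
open Matrix

theorem aux_trace {n : ℕ} (X Z : Matrix (Fin n) (Fin n) ℝ) (hX : X.PosDef)
    (hZ : Z.IsHermitian) : 2 * Z.trace - (Z * X * Z).trace ≤ X⁻¹.trace := by
  have h1 := (hX.posSemidef.mul_mul_conjTranspose_same (X⁻¹ - Z)).trace_nonneg
  have hH : (X⁻¹ - Z)ᴴ = X⁻¹ - Z := (hX.inv.isHermitian.sub hZ)
  have hu : IsUnit X.det := (Matrix.isUnit_iff_isUnit_det X).1 hX.isUnit
  have e : (X⁻¹ - Z) * X * (X⁻¹ - Z) = X⁻¹ - Z - Z + Z * X * Z := by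
    have e1 : (X⁻¹ - Z) * X = 1 - Z * X := by rw [sub_mul, Matrix.nonsing_inv_mul X hu]
    have e2 : Z * X * X⁻¹ = Z := by
      rw [Matrix.mul_assoc, Matrix.mul_nonsing_inv X hu, Matrix.mul_one]
    rw [e1, sub_mul, Matrix.one_mul, mul_sub, e2]
    abel
  rw [hH, e, Matrix.trace_add, Matrix.trace_sub, Matrix.trace_sub] at h1
  linarith

theorem aux_convex {n : ℕ} (X Y : Matrix (Fin n) (Fin n) ℝ) (hX : X.PosDef) (hY : Y.PosDef)
    (a b : ℝ) (ha : 0 ≤ a) (hb : 0 ≤ b) (hab : a + b = 1) (hM : (a • X + b • Y).PosDef) :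
    (a • X + b • Y)⁻¹.trace ≤ a * X⁻¹.trace + b * Y⁻¹.trace := by
  have hZ := hM.inv.isHermitian
  have hu := (Matrix.isUnit_iff_isUnit_det _).1 hM.isUnit
  have e : (a • X + b • Y)⁻¹ * (a • X + b • Y) * (a • X + b • Y)⁻¹ = (a • X + b • Y)⁻¹ := by
    rw [Matrix.nonsing_inv_mul _ hu, Matrix.one_mul]
  generalize (a • X + b • Y)⁻¹ = Z at *
  have h1 := mul_le_mul_of_nonneg_left (aux_trace X Z hX hZ) ha
  have h2 := mul_le_mul_of_nonneg_left (aux_trace Y Z hY hZ) hb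
  have e2 := congrArg Matrix.trace e
  simp only [mul_add, add_mul, Matrix.mul_smul, Matrix.smul_mul, Matrix.trace_add,
    Matrix.trace_smul, smul_eq_mul] at e2
  have hb' : b = 1 - a := by linarith
  subst hb'
  linarith

theorem aux_log (c x y a b : ℝ) (hc : 0 ≤ c) (hx : 0 ≤ x) (hy : 0 ≤ y) (ha : 0 ≤ a)
    (hb : 0 ≤ b) (hab : a + b = 1) :
    a * Real.logb 2 (1 + c * x) + b * Real.logb 2 (1 + c * y)
      ≤ Real.logb 2 (1 + c * (a * x + b * y)) := by
  have h := strictConcaveOn_log_Ioi.concaveOn.2 (x := 1 + c * x) (y := 1 + c * y)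
    (Set.mem_Ioi.2 (by positivity)) (Set.mem_Ioi.2 (by positivity)) ha hb hab
  have e : a • (1 + c * x) + b • (1 + c * y) = 1 + c * (a * x + b * y) := by
    simp only [smul_eq_mul]; linear_combination hab
  rw [e] at h
  simp only [smul_eq_mul] at h
  have h2 : 0 < Real.log 2 := Real.log_pos (by norm_num)
  have := div_le_div_of_nonneg_right h h2.le
  simp only [Real.logb]
  calc _ = _ := by ring
    _ ≤ _ := this

/-- **The power allocation problem `P̄` is convex.** The feasible set (per-subcarrier
power limits, total power constraint, and ACRB constraint) is convex and the
Gaussian-input mutual information `f(p) = ∑ i, log₂(1 + c i * p i)` is concave on it. -/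
theorem stmt_9 {n d : ℕ} (A : Fin d → Matrix (Fin n) (Fin n) ℝ)
    (J : Matrix (Fin n) (Fin n) ℝ)
    (hAsymm : ∀ i, (A i).IsSymm) (hApsd : ∀ i, (A i).PosSemidef)
    (hJsymm : J.IsSymm) (hJ : J.PosDef)
    (c : Fin d → ℝ) (hc : ∀ i, 0 ≤ c i)
    (P Pmax D : ℝ) (hP : 0 < P) (hPmax : 0 < Pmax) (hD : 0 < D) :
    Convex ℝ { p : Fin d → ℝ |
        (∀ i, 0 ≤ p i ∧ p i ≤ Pmax) ∧ (∑ i, p i) ≤ P ∧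
          ((∑ i, p i • A i) + J)⁻¹.trace ≤ D } ∧
      ConcaveOn ℝ { p : Fin d → ℝ |
        (∀ i, 0 ≤ p i ∧ p i ≤ Pmax) ∧ (∑ i, p i) ≤ P ∧
          ((∑ i, p i • A i) + J)⁻¹.trace ≤ D }
        (fun p => ∑ i, Real.logb 2 (1 + c i * p i)) := by
  have hpd : ∀ p : Fin d → ℝ, (∀ i, 0 ≤ p i) → ((∑ i, p i • A i) + J).PosDef := by
    intro p hp
    exact Matrix.PosDef.posSemidef_add
      (Matrix.posSemidef_sum _ fun i _ => (hApsd i).smul (hp i)) hJ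
  have hconv : Convex ℝ { p : Fin d → ℝ |
        (∀ i, 0 ≤ p i ∧ p i ≤ Pmax) ∧ (∑ i, p i) ≤ P ∧
          ((∑ i, p i • A i) + J)⁻¹.trace ≤ D } := by
    rintro p ⟨hp1, hp2, hp3⟩ q ⟨hq1, hq2, hq3⟩ a b ha hb hab
    have hnn : ∀ i, 0 ≤ (a • p + b • q) i := fun i => by
      have := (hp1 i).1
      have := (hq1 i).1
      simp only [Pi.add_apply, Pi.smul_apply, smul_eq_mul]
      positivity
    have hb' : b = 1 - a := by linarith
    refine ⟨fun i => ⟨hnn i, ?_⟩, ?_, ?_⟩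
    · simp only [Pi.add_apply, Pi.smul_apply, smul_eq_mul]
      have h1 := mul_le_mul_of_nonneg_left (hp1 i).2 ha
      have h2 := mul_le_mul_of_nonneg_left (hq1 i).2 hb
      subst hb'
      linarith
    · simp only [Pi.add_apply, Pi.smul_apply, smul_eq_mul, Finset.sum_add_distrib,
        ← Finset.mul_sum]
      have h1 := mul_le_mul_of_nonneg_left hp2 ha
      have h2 := mul_le_mul_of_nonneg_left hq2 hb
      subst hb'
      linarith
    · have e : (∑ i, (a • p + b • q) i • A i) + J
          = a • ((∑ i, p i • A i) + J) + b • ((∑ i, q i • A i) + J) := by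
        have hJ1 : J = a • J + b • J := by rw [← add_smul, hab, one_smul]
        simp only [Pi.add_apply, Pi.smul_apply, smul_eq_mul, add_smul, Finset.sum_add_distrib,
          smul_add, Finset.smul_sum, smul_smul]
        conv_lhs => rw [hJ1]
        abel
      have hM := hpd _ hnn
      rw [e] at hM ⊢
      have h := aux_convex _ _ (hpd p fun i => (hp1 i).1) (hpd q fun i => (hq1 i).1)
        a b ha hb hab hM
      have h1 := mul_le_mul_of_nonneg_left hp3 ha
      have h2 := mul_le_mul_of_nonneg_left hq3 hb
      subst hb'
      linarith
  refine ⟨hconv, hconv, ?_⟩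
  rintro p ⟨hp1, -, -⟩ q ⟨hq1, -, -⟩ a b ha hb hab
  simp only [smul_eq_mul, Finset.mul_sum, ← Finset.sum_add_distrib]
  exact Finset.sum_le_sum fun i _ =>
    aux_log (c i) (p i) (q i) a b (hc i) (hp1 i).1 (hq1 i).1 ha hb hab
end

section
/- Let N ≥ 1, let w : {0, 1, …, N−1} → ℝ be monotone nondecreasing, and let P, P_max be reals with P_max > 0 and 0 ≤ P ≤ N · P_max. Define the greedy top-filling allocation x*_n = min( P_max, max( 0, P − (N−1−n) · P_max ) ) for n = 0, …, N−1. Then x* is feasible, i.e. 0 ≤ x*_n ≤ P_max for all n and ∑_{n=0}^{N−1} x*_n = P, and for every x : {0, …, N−1} → ℝ with 0 ≤ x_n ≤ P_max for all n and ∑_{n=0}^{N−1} x_n = P, one has ∑_{n=0}^{N−1} w_n x_n ≤ ∑_{n=0}^{N−1} w_n x*_n. -/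
/-- **Greedy top-filling maximizes a monotone-weighted sum.** For nondecreasing weights
`w` on `{0, …, N-1}` and `0 ≤ P ≤ N * Pmax`, the allocation
`x*_n = min(Pmax, max(0, P - (N-1-n) * Pmax))` is feasible (it satisfies the
per-coordinate bounds and sums to `P`) and maximizes `∑ n, w n * x n` over all feasible
allocations. -/
theorem stmt_10 (N : ℕ) (hN : 1 ≤ N) (w : Fin N → ℝ) (hw : Monotone w)
    (P Pmax : ℝ) (hPmax : 0 < Pmax) (hP0 : 0 ≤ P) (hPN : P ≤ N * Pmax) :
    (∀ n : Fin N,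
        0 ≤ min Pmax (max 0 (P - ((N : ℝ) - 1 - n) * Pmax)) ∧
          min Pmax (max 0 (P - ((N : ℝ) - 1 - n) * Pmax)) ≤ Pmax) ∧
      (∑ n : Fin N, min Pmax (max 0 (P - ((N : ℝ) - 1 - n) * Pmax))) = P ∧
      ∀ x : Fin N → ℝ, (∀ n, 0 ≤ x n ∧ x n ≤ Pmax) → (∑ n, x n) = P →
        (∑ n, w n * x n) ≤
          ∑ n : Fin N, w n * min Pmax (max 0 (P - ((N : ℝ) - 1 - n) * Pmax)) := by
  have hsum : (∑ n : Fin N, min Pmax (max 0 (P - ((N : ℝ) - 1 - n) * Pmax))) = P := by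
    rw [Fin.sum_univ_eq_sum_range
      (fun n : ℕ => min Pmax (max 0 (P - ((N : ℝ) - 1 - (n : ℝ)) * Pmax))) N]
    have h1 : ∀ n ∈ Finset.range N, min Pmax (max 0 (P - ((N : ℝ) - 1 - (n : ℝ)) * Pmax)) =
        (fun k : ℕ => max 0 (P - ((N : ℝ) - (k : ℝ)) * Pmax)) (n + 1) -
        (fun k : ℕ => max 0 (P - ((N : ℝ) - (k : ℝ)) * Pmax)) n := by
      intro n _
      have e1 : P - ((N : ℝ) - ((n + 1 : ℕ) : ℝ)) * Pmax
          = P - ((N : ℝ) - 1 - (n : ℝ)) * Pmax := by push_cast; ring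
      have e2 : P - ((N : ℝ) - (n : ℝ)) * Pmax
          = P - ((N : ℝ) - 1 - (n : ℝ)) * Pmax - Pmax := by ring
      simp only [e1, e2]
      generalize P - ((N : ℝ) - 1 - (n : ℝ)) * Pmax = y
      grind
    rw [Finset.sum_congr rfl h1, Finset.sum_range_sub (fun k : ℕ => max 0 (P - ((N : ℝ) - (k : ℝ)) * Pmax))]
    have e3 : P - ((N : ℝ) - ((0 : ℕ) : ℝ)) * Pmax ≤ 0 := by push_cast; linarith
    have e4 : P - ((N : ℝ) - (N : ℝ)) * Pmax = P := by ring
    simp only [e4, max_eq_left e3, max_eq_right hP0, sub_zero]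
  refine ⟨fun n => ⟨le_min hPmax.le (le_max_left _ _), min_le_left _ _⟩, hsum, ?_⟩
  intro x hx hxs
  obtain ⟨m, hm, hmin⟩ := wellFounded_lt.has_min
    {n : Fin N | n.val = N - 1 ∨ 0 < P - ((N : ℝ) - 1 - n) * Pmax}
    ⟨⟨N - 1, by omega⟩, Or.inl rfl⟩
  have key : ∀ n : Fin N, 0 ≤ (w n - w m) *
      (min Pmax (max 0 (P - ((N : ℝ) - 1 - n) * Pmax)) - x n) := by
    intro n
    rcases lt_trichotomy n m with h | h | h
    · have h2 : P - ((N : ℝ) - 1 - n) * Pmax ≤ 0 := by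
        by_contra h3
        exact hmin n (Or.inr (not_le.mp h3)) h
      rw [max_eq_left h2, min_eq_right hPmax.le]
      exact mul_nonneg_of_nonpos_of_nonpos (by linarith [hw h.le]) (by linarith [(hx n).1])
    · simp [h]
    · have h2 : 0 < P - ((N : ℝ) - 1 - m) * Pmax := by
        rcases hm with h3 | h3
        · have := n.isLt
          have : m.val < n.val := h
          omega
        · exact h3
      have h4 : (m : ℝ) + 1 ≤ (n : ℝ) := by
        have : m.val + 1 ≤ n.val := h
        exact_mod_cast this
      have h5 : Pmax ≤ P - ((N : ℝ) - 1 - n) * Pmax := by nlinarith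
      rw [min_eq_left (h5.trans (le_max_right _ _))]
      exact mul_nonneg (by linarith [hw h.le]) (by linarith [(hx n).2])
  have hs := Finset.sum_nonneg (fun n (_ : n ∈ Finset.univ) => key n)
  simp only [sub_mul, mul_sub, Finset.sum_sub_distrib, ← Finset.mul_sum] at hs hsum ⊢
  rw [hsum, hxs] at hs
  linarith
end

section
/- Let N ≥ 1, let w : {0, 1, …, N−1} → ℝ be nonnegative and monotone nondecreasing, let P, P_max be reals with P_max > 0 and 0 ≤ P ≤ N · P_max, and let a₁, …, a_K > 0 and b₁, …, b_K > 0 be reals. Define the greedy top-filling allocation x*_n = min( P_max, max( 0, P − (N−1−n) · P_max ) ). Then for every x : {0, …, N−1} → ℝ with 0 ≤ x_n ≤ P_max for all n and ∑_{n=0}^{N−1} x_n = P, one has ∑_{k=1}^K 1 / ( a_k · ∑_{n=0}^{N−1} w_n x*_n + b_k ) ≤ ∑_{k=1}^K 1 / ( a_k · ∑_{n=0}^{N−1} w_n x_n + b_k ). -/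
theorem greedy_sum_aux (P Q : ℝ) (hQ : 0 < Q) (hP : 0 ≤ P) (N : ℕ) :
    ∑ i ∈ Finset.range N, min Q (max 0 (P - (i : ℝ) * Q)) = min P (N * Q) := by
  induction N with
  | zero => simp [hP]
  | succ N ih =>
    rw [Finset.sum_range_succ, ih]
    push_cast
    have e : ((N : ℝ) + 1) * Q = N * Q + Q := by ring
    rw [e]
    generalize (N : ℝ) * Q = t
    simp only [min_def, max_def]
    split_ifs <;> linarith

theorem greedy_sum (P Q : ℝ) (hQ : 0 < Q) (hP : 0 ≤ P) (N : ℕ) (hPN : P ≤ N * Q) :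
    ∑ n : Fin N, min Q (max 0 (P - ((N : ℝ) - 1 - n) * Q)) = P := by
  have h := greedy_sum_aux P Q hQ hP N
  rw [min_eq_left hPN, ← Finset.sum_range_reflect, Finset.sum_range] at h
  rw [← h]
  refine Finset.sum_congr rfl fun n _ => ?_
  have : ((N - 1 - (n : ℕ) : ℕ) : ℝ) = (N : ℝ) - 1 - n := by
    have := n.2
    rw [Nat.cast_sub (by omega), Nat.cast_sub (by omega)]
    simp
  rw [h, this]


/-- **Theorem 2 of the paper: the greedy top-filling allocation minimizes the ACRB.**
For nonnegative nondecreasing weights `w`, positive constants `a k`, `b k`, and any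
feasible power allocation `x` (per-coordinate bounds `0 ≤ x n ≤ Pmax`, total power
`∑ x n = P`), the greedy top-filling allocation
`x*_n = min(Pmax, max(0, P - (N-1-n) * Pmax))` satisfies
`∑ k, 1 / (a k * ∑ n, w n * x*_n + b k) ≤ ∑ k, 1 / (a k * ∑ n, w n * x n + b k)`. -/
theorem stmt_11 (N : ℕ) (hN : 1 ≤ N) (w : Fin N → ℝ)
    (hw0 : ∀ n, 0 ≤ w n) (hw : Monotone w)
    (P Pmax : ℝ) (hPmax : 0 < Pmax) (hP0 : 0 ≤ P) (hPN : P ≤ N * Pmax)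
    (K : ℕ) (a b : Fin K → ℝ) (ha : ∀ k, 0 < a k) (hb : ∀ k, 0 < b k) :
    ∀ x : Fin N → ℝ, (∀ n, 0 ≤ x n ∧ x n ≤ Pmax) → (∑ n, x n) = P →
      (∑ k : Fin K, 1 /
          (a k * (∑ n : Fin N, w n * min Pmax (max 0 (P - ((N : ℝ) - 1 - n) * Pmax))) + b k)) ≤
        ∑ k : Fin K, 1 / (a k * (∑ n : Fin N, w n * x n) + b k) := by
  intro x hx hsum
  have hy := greedy_sum P Pmax hPmax hP0 N hPN
  have hfl : (⌊P / Pmax⌋₊ : ℝ) * Pmax ≤ P := by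
    rw [← le_div_iff₀ hPmax]; exact Nat.floor_le (by positivity)
  have hfu : P < ((⌊P / Pmax⌋₊ : ℝ) + 1) * Pmax := by
    rw [← div_lt_iff₀ hPmax]; exact Nat.lt_floor_add_one _
  set m := ⌊P / Pmax⌋₊
  let n0 : Fin N := ⟨N - 1 - m, by omega⟩
  have key : ∑ n : Fin N, w n * x n ≤
      ∑ n : Fin N, w n * min Pmax (max 0 (P - ((N : ℝ) - 1 - n) * Pmax)) := by
    have hpt : ∀ n : Fin N, 0 ≤ (w n - w n0) *
        (min Pmax (max 0 (P - ((N : ℝ) - 1 - n) * Pmax)) - x n) := by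
      intro n
      obtain ⟨h0, h1⟩ := hx n
      rcases lt_trichotomy n n0 with h | h | h
      · have hn : (n : ℕ) + m + 2 ≤ N := by
          have : (n : ℕ) < N - 1 - m := h
          omega
        have hn' : (n : ℝ) + m + 2 ≤ N := by exact_mod_cast hn
        have h2 : P - ((N : ℝ) - 1 - n) * Pmax ≤ 0 := by nlinarith
        rw [max_eq_left h2, min_eq_right hPmax.le]
        exact mul_nonneg_of_nonpos_of_nonpos (sub_nonpos.2 (hw h.le)) (by linarith)
      · simp [h]
      · have hn : N ≤ (n : ℕ) + m := by
          have : N - 1 - m < (n : ℕ) := h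
          omega
        have hn' : (N : ℝ) ≤ n + m := by exact_mod_cast hn
        have h2 : Pmax ≤ P - ((N : ℝ) - 1 - n) * Pmax := by nlinarith
        rw [min_eq_left (h2.trans (le_max_right _ _))]
        exact mul_nonneg (sub_nonneg.2 (hw h.le)) (by linarith)
    have hs := Finset.sum_nonneg fun n (_ : n ∈ Finset.univ) => hpt n
    simp only [sub_mul, mul_sub, Finset.sum_sub_distrib, ← Finset.mul_sum] at hs hy
    rw [hy, hsum] at hs
    simp only [sub_mul]
    linarith
  have hx0 : 0 ≤ ∑ n : Fin N, w n * x n :=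
    Finset.sum_nonneg fun n _ => mul_nonneg (hw0 n) (hx n).1
  refine Finset.sum_le_sum fun k _ => ?_
  have h1 := mul_nonneg (ha k).le hx0
  have h2 := mul_le_mul_of_nonneg_left key (ha k).le
  have h3 := hb k
  exact one_div_le_one_div_of_le (by linarith) (by linarith)
end
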